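/- Let (N,R) be an STP instance with N=(V,E,σ). Let z∈R be a terminal of degree at least 2, let e'={z,u} be an edge of minimum cost among the edges incident to z, and let e''={z,v} be an edge of minimum cost among the edges incident to z other than e'. If there exists a terminal z'∈R with z'≠z such that σ(e'') ≥ σ(e') + d_N(u,z'), then there exists at least one SMT of (N,R) containing the edge e'. -/

import Mathlib

open SimpleGraph

variable {V : Type*}

/-- The cost of a walk: the sum of the costs of its edges. -/
def walkCost {G : SimpleGraph V} (σ : Sym2 V → ℕ) {u v : V} (w : G.Walk u v) : ℕ :=
  (w.edges.map σ).sum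

/-- The shortest-path distance `d_N(u,v)` in the network `(G, σ)`. -/
noncomputable def netDist (G : SimpleGraph V) (σ : Sym2 V → ℕ) (u v : V) : ℕ :=
  sInf {c | ∃ w : G.Walk u v, walkCost σ w = c}

/-- Shortest-path distance as a function on unordered pairs. -/
noncomputable def sym2Dist (G : SimpleGraph V) (σ : Sym2 V → ℕ) (e : Sym2 V) : ℕ :=
  sInf {c | ∃ x y : V, e = s(x, y) ∧ ∃ w : G.Walk x y, walkCost σ w = c}

/-- The cost of a subgraph: the sum of the costs of its edges. -/
noncomputable def subCost [Fintype V] {G : SimpleGraph V} (σ : Sym2 V → ℕ)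
    (H : G.Subgraph) : ℕ :=
  ∑ e ∈ H.edgeSet.toFinite.toFinset, σ e

/-- A Steiner tree for terminals `R`: a subtree of `G` whose vertex set contains `R`. -/
def IsSteinerTree {G : SimpleGraph V} (R : Set V) (H : G.Subgraph) : Prop :=
  H.coe.IsTree ∧ R ⊆ H.verts

/-- The minimum cost of a Steiner tree for `(G, σ, R)`. -/
noncomputable def csmt [Fintype V] (G : SimpleGraph V) (σ : Sym2 V → ℕ) (R : Set V) : ℕ :=
  sInf {c | ∃ H : G.Subgraph, IsSteinerTree R H ∧ subCost σ H = c}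

/-- A Steiner minimal tree (SMT). -/
def IsSMT [Fintype V] (G : SimpleGraph V) (σ : Sym2 V → ℕ) (R : Set V)
    (H : G.Subgraph) : Prop :=
  IsSteinerTree R H ∧ subCost σ H = csmt G σ R

/-- The sub-SMT cost `l*(u, I) = csmt(N, I ∪ {u})`. -/
noncomputable def lstar [Fintype V] (G : SimpleGraph V) (σ : Sym2 V → ℕ)
    (u : V) (I : Set V) : ℕ :=
  csmt G σ (I ∪ {u})

/-- The cost of a minimum spanning tree of the complete network on `S`
with edge weights `w` (as a function on unordered pairs of `V`). -/
noncomputable def mstCost [Fintype V] (w : Sym2 V → ℕ) (S : Set V) : ℕ :=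
  sInf {c | ∃ T : SimpleGraph ↥S, T.IsTree ∧
    c = ∑ e ∈ T.edgeSet.toFinite.toFinset, w (e.map (Subtype.val : ↥S → V))}

-- Auxiliary fold computing the Steiner distance of a walk: the pair of
-- (the maximum cost among the already completed elementary segments,
-- the cost of the initial elementary segment), where the walk is split at
-- every visited terminal of `R`.
open Classical in
noncomputable def segMax {G : SimpleGraph V} (σ : Sym2 V → ℕ) (R : Set V) :
    {a b : V} → G.Walk a b → ℕ × ℕ
  | _, _, SimpleGraph.Walk.nil => (0, 0)
  | _, _, @SimpleGraph.Walk.cons _ _ a c _ _ w =>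
      let p := segMax σ R w
      if c ∈ R then (max p.1 p.2, σ s(a, c)) else (p.1, σ s(a, c) + p.2)

/-- The Steiner distance of a walk with respect to terminals `R`:
the maximum cost among its elementary subpaths (obtained by splitting the
walk at the intermediate terminals). -/
noncomputable def walkSD {G : SimpleGraph V} (σ : Sym2 V → ℕ) (R : Set V)
    {a b : V} (w : G.Walk a b) : ℕ :=
  max (segMax σ R w).1 (segMax σ R w).2

/-- The restricted bottleneck Steiner distance `s̄(u,v)`: the minimum Steiner
distance among all paths connecting `u` and `v` that avoid the edge `{u,v}`. -/
noncomputable def restrictedBottleneck (G : SimpleGraph V) (σ : Sym2 V → ℕ)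
    (R : Set V) (u v : V) : ℕ :=
  sInf {c | ∃ w : G.Walk u v, w.IsPath ∧ s(u, v) ∉ w.edges ∧ walkSD σ R w = c}

/-- The bottleneck Steiner distance as a function on unordered pairs. -/
noncomputable def sym2Bottleneck (G : SimpleGraph V) (σ : Sym2 V → ℕ) (R : Set V)
    (e : Sym2 V) : ℕ :=
  sInf {c | ∃ x y : V, e = s(x, y) ∧ ∃ w : G.Walk x y, w.IsPath ∧ walkSD σ R w = c}

/-- A connected subgraph containing the edge `s(a, b)` has a spanning tree containing it. -/
theorem exists_isTree_coe_of_adj {G : SimpleGraph V} {H : G.Subgraph} (hH : H.Connected)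
    {a b : V} (hab : H.Adj a b) :
    ∃ K : G.Subgraph, K.coe.IsTree ∧ K.verts = H.verts ∧ K ≤ H ∧ K.Adj a b := by
  classical
  let a' : H.verts := ⟨a, H.edge_vert hab⟩
  let b' : H.verts := ⟨b, H.edge_vert hab.symm⟩
  have hne : a' ≠ b' := fun h => hab.ne (congrArg Subtype.val h)
  have hac : (⊥ ⊔ SimpleGraph.edge a' b' : SimpleGraph H.verts).IsAcyclic :=
    isAcyclic_bot.sup_edge_of_not_reachable (by simpa using hne)
  have hle : (⊥ ⊔ SimpleGraph.edge a' b' : SimpleGraph H.verts) ≤ H.coe := by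
    rw [bot_sup_eq, SimpleGraph.edge_le_iff]
    exact Or.inr hab
  obtain ⟨F, hF, hFH, hFt⟩ := hH.coe.exists_isTree_le_of_le_of_isAcyclic hle hac
  refine ⟨{ verts := H.verts
            Adj := fun x y => ∃ (hx : x ∈ H.verts) (hy : y ∈ H.verts), F.Adj ⟨x, hx⟩ ⟨y, hy⟩
            adj_sub := fun ⟨_, _, h⟩ => H.adj_sub (hFH h)
            edge_vert := fun ⟨hx, _, _⟩ => hx
            symm := ⟨fun _ _ ⟨hx, hy, h⟩ => ⟨hy, hx, h.symm⟩⟩ }, ?_, rfl, ?_, ?_⟩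
  · convert hFt using 1
    ext x y
    exact ⟨fun ⟨_, _, h⟩ => h, fun h => ⟨x.2, y.2, h⟩⟩
  · exact ⟨le_rfl, fun x y ⟨_, _, h⟩ => hFH h⟩
  · exact ⟨a'.2, b'.2, hF (Or.inr ((SimpleGraph.edge_adj ..).2 ⟨Or.inl ⟨rfl, rfl⟩, hne⟩))⟩

/-- In a connected network every terminal set has a Steiner minimal tree. -/
theorem exists_isSMT [Fintype V] {G : SimpleGraph V} (σ : Sym2 V → ℕ) (hG : G.Connected)
    (R : Set V) : ∃ H : G.Subgraph, IsSMT G σ R H := by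
  have hne : {c | ∃ H : G.Subgraph, IsSteinerTree R H ∧ subCost σ H = c}.Nonempty := by
    obtain ⟨T, hT, hTt⟩ := hG.exists_isTree_le
    refine ⟨_, SimpleGraph.toSubgraph T hT, ⟨⟨?_, ?_⟩, fun x _ => Set.mem_univ x⟩, rfl⟩
    · exact (hTt.connected.toSubgraph hT).coe
    · exact hTt.isAcyclic.comap
        (⟨Subtype.val, fun h => h⟩ : (SimpleGraph.toSubgraph T hT).coe →g T)
        Subtype.val_injective
  obtain ⟨H, hH, hc⟩ := Nat.sInf_mem hne
  exact ⟨H, hH, hc⟩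

/-- In a connected network the distance is attained by a walk. -/
theorem exists_walkCost_eq_netDist {G : SimpleGraph V} (σ : Sym2 V → ℕ) (hG : G.Connected)
    (u v : V) : ∃ w : G.Walk u v, walkCost σ w = netDist G σ u v :=
  Nat.sInf_mem (s := {c | ∃ w : G.Walk u v, walkCost σ w = c})
    (let ⟨w⟩ := hG.preconnected u v; ⟨_, w, rfl⟩)

theorem List.sum_toFinset_le_sum_map {α : Type*} [DecidableEq α] (f : α → ℕ) (l : List α) :
    ∑ x ∈ l.toFinset, f x ≤ (l.map f).sum := by
  induction l with
  | nil => simp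
  | cons a l ih =>
    rw [List.toFinset_cons, List.map_cons, List.sum_cons]
    by_cases ha : a ∈ l.toFinset
    · rw [Finset.insert_eq_of_mem ha]
      lia
    · rw [Finset.sum_insert ha]
      lia

/-- Deleting an edge `s(a, b)` from a connected subgraph and adding a walk from `a` to `c`
leaves a connected subgraph, provided `b` and `c` are joined by a walk avoiding `a`. -/
theorem connected_deleteEdges_sup_toSubgraph {G : SimpleGraph V} {T : G.Subgraph}
    (hT : T.Connected) {a b c : T.verts} (q : G.Walk (a : V) (c : V))
    (p : T.coe.Walk b c) (hp : a ∉ p.support) :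
    (T.deleteEdges {s((a : V), (b : V))} ⊔ q.toSubgraph).Connected := by
  classical
  set K := T.deleteEdges {s((a : V), (b : V))} ⊔ q.toSubgraph with hK
  let r : V → V → Prop := fun x y => ∃ w : G.Walk x y, w.toSubgraph ≤ K
  have r_symm {x y} : r x y → r y x := fun ⟨w, h⟩ => ⟨w.reverse, by simpa using h⟩
  have r_trans {x y t} : r x y → r y t → r x t := fun ⟨w, h⟩ ⟨w', h'⟩ =>
    ⟨w.append w', by simpa using ⟨h, h'⟩⟩
  have r_refl {x} (hx : x ∈ K.verts) : r x x := ⟨.nil, by simpa using hx⟩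
  have r_adj {x y} (h : K.Adj x y) : r x y :=
    ⟨.cons h.adj_sub .nil, by
      rw [Walk.toSubgraph, Walk.toSubgraph, sup_le_iff]
      exact ⟨subgraphOfAdj_le_of_adj K h, (singletonSubgraph_le_iff ..).2 (K.edge_vert h.symm)⟩⟩
  have hTK : T.verts ⊆ K.verts := fun x hx => Or.inl hx
  have hqK : q.toSubgraph ≤ K := le_sup_right
  have r_avoid {x y : T.verts} (w : T.coe.Walk x y) (hw : a ∉ w.support) : r x y := by
    induction w with
    | nil => exact r_refl (hTK (Subtype.property _))
    | @cons x y t h w ih =>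
      rw [Walk.support_cons, List.mem_cons, not_or] at hw
      refine r_trans (r_adj (Or.inl ?_)) (ih hw.2)
      have hy : a ≠ y := fun e => hw.2 (e ▸ w.start_mem_support)
      rw [Subgraph.deleteEdges_adj]
      refine ⟨h, fun hmem => ?_⟩
      rcases Sym2.eq_iff.1 hmem with ⟨h1, -⟩ | ⟨-, h1⟩
      · exact hw.1 (Subtype.ext h1.symm)
      · exact hy (Subtype.ext h1.symm)
  have r_ab : r a b := r_trans ⟨q, hqK⟩ (r_symm (r_avoid p hp))
  have r_tadj {x y : T.verts} (h : T.coe.Adj x y) : r x y := by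
    by_cases he : s((x : V), (y : V)) = s((a : V), (b : V))
    · rcases Sym2.eq_iff.1 he with ⟨h1, h2⟩ | ⟨h1, h2⟩
      · rwa [h1, h2]
      · rw [h1, h2]
        exact r_symm r_ab
    · exact r_adj (Or.inl ((Subgraph.deleteEdges_adj ..).2 ⟨h, he⟩))
  have r_walk {x y : T.verts} (w : T.coe.Walk x y) : r x y := by
    induction w with
    | nil => exact r_refl (hTK (Subtype.property _))
    | cons h w ih => exact r_trans (r_tadj h) ih
  have r_a {x : V} (hx : x ∈ K.verts) : r x a := by
    rcases hx with hx | hx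
    · obtain ⟨w⟩ := hT.coe.preconnected ⟨x, hx⟩ a
      exact r_walk w
    · have hx' : x ∈ q.support := by simpa using hx
      refine r_symm ⟨q.takeUntil x hx', le_trans ?_ hqK⟩
      conv_rhs => rw [← q.take_spec hx', Walk.toSubgraph_append]
      exact le_sup_left
  rw [Subgraph.connected_iff]
  refine ⟨?_, a, hTK a.2⟩
  rw [Subgraph.preconnected_iff_forall_exists_walk_subgraph]
  exact fun hx hy => r_trans (r_a hx) (r_symm (r_a hy))

/-- Nearest-vertex test. If `e' = {z,u}` is a cheapest edge at the
terminal `z`, `e'' = {z,v}` a second-cheapest one, and some other terminal `z'`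
satisfies `σ(e'') ≥ σ(e') + d_N(u,z')`, then some SMT contains `e'`. -/
theorem nearest_vertex_in_some_smt
    [Fintype V] (G : SimpleGraph V) (σ : Sym2 V → ℕ)
    (hconn : G.Connected) (hpos : ∀ e ∈ G.edgeSet, 0 < σ e)
    (R : Set V) (hRne : R.Nonempty)
    (z u v : V) (hz : z ∈ R) (hdeg : 2 ≤ (G.neighborSet z).ncard)
    (hadj1 : G.Adj z u)
    (hmin1 : ∀ y : V, G.Adj z y → σ s(z, u) ≤ σ s(z, y))
    (hadj2 : G.Adj z v) (hne : s(z, v) ≠ s(z, u))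
    (hmin2 : ∀ y : V, G.Adj z y → s(z, y) ≠ s(z, u) → σ s(z, v) ≤ σ s(z, y))
    (z' : V) (hz' : z' ∈ R) (hzz' : z' ≠ z)
    (hcond : σ s(z, u) + netDist G σ u z' ≤ σ s(z, v)) :
    ∃ H : G.Subgraph, IsSMT G σ R H ∧ s(z, u) ∈ H.edgeSet := by
  classical
  obtain ⟨T, ⟨hTt, hRT⟩, hTc⟩ := exists_isSMT σ hconn R
  by_cases hzu : T.Adj z u
  · exact ⟨T, ⟨⟨hTt, hRT⟩, hTc⟩, hzu⟩
  obtain ⟨w, hw⟩ := exists_walkCost_eq_netDist σ hconn u z'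
  obtain ⟨p, hp⟩ := (hTt.connected.preconnected ⟨z, hRT hz⟩ ⟨z', hRT hz'⟩).exists_isPath
  cases p with
  | nil => exact absurd rfl hzz'
  | @cons _ y _ hzy p =>
  rw [Walk.cons_isPath_iff] at hp
  have hTzy : T.Adj z y := hzy
  have hcost : σ s(z, v) ≤ σ s(z, y) := hmin2 y hTzy.adj_sub fun h => hzu <| by
    rwa [← Subgraph.mem_edgeSet, ← h]
  let q : G.Walk z z' := .cons hadj1 w
  obtain ⟨K, hKt, hKv, hKle, hKadj⟩ := exists_isTree_coe_of_adj
    (connected_deleteEdges_sup_toSubgraph ⟨hTt.connected⟩ q p hp.2) (a := z) (b := u)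
    (Or.inr (by simp [q]))
  have hKS : IsSteinerTree R K := ⟨hKt, fun x hx => hKv ▸ Or.inl (hRT hx)⟩
  refine ⟨K, ⟨hKS, le_antisymm ?_ (Nat.sInf_le ⟨K, hKS, rfl⟩)⟩, hKadj⟩
  rw [← hTc]
  have hmem : s(z, (y : V)) ∈ T.edgeSet.toFinite.toFinset := by simpa using hTzy
  have hsub : K.edgeSet.toFinite.toFinset ⊆
      T.edgeSet.toFinite.toFinset.erase s(z, (y : V)) ∪ q.edges.toFinset := by
    intro e he
    have he' := Subgraph.edgeSet_mono hKle ((Set.Finite.mem_toFinset _).1 he)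
    rw [Subgraph.edgeSet_sup, Walk.edgeSet_toSubgraph] at he'
    simp only [Finset.mem_union, Finset.mem_erase, Set.Finite.mem_toFinset, List.mem_toFinset]
    refine he'.imp (fun h => ?_) id
    induction e with | h x y =>
    rw [Subgraph.mem_edgeSet, Subgraph.deleteEdges_adj] at h
    exact ⟨h.2, h.1⟩
  have hq : ∑ e ∈ q.edges.toFinset, σ e ≤ σ s(z, u) + netDist G σ u z' := by
    rw [← hw]
    simpa [q, walkCost] using List.sum_toFinset_le_sum_map σ q.edges
  have herase := Finset.sum_erase_add _ σ hmem
  have hle := Finset.sum_le_sum_of_subset (f := σ) hsub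
  have hunion := Finset.sum_union_inter (f := σ)
    (s₁ := T.edgeSet.toFinite.toFinset.erase s(z, (y : V))) (s₂ := q.edges.toFinset)
  unfold subCost
  lia
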